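/- arXiv:2303.13901 — 2 statements merged into one kernel-verified Lean document; each statement's English description precedes it below -/
import Mathlib

section
/- Let n ≥ 1, κ > 0, let μ0 be a compactly supported Borel probability measure on ℝ^n absolutely continuous with respect to Lebesgue measure, μ1 a compactly supported Borel probability measure with HK_κ(μ0,μ1) > 0, and let (v0, α0, μ1^⊥) be the HK logarithmic map components of μ1 at μ0. Set s'(0) = (SHK_κ(μ0,μ1)/κ)/sin(SHK_κ(μ0,μ1)/κ), and define the SHK logarithmic components v0^S = s'(0)·v0, α0^S = s'(0)·(α0 + HK_κ²(μ0,μ1)/κ²), and (μ1^S)^⊥ = s'(0)²·μ1^⊥. Then SHK_κ²(μ0,μ1) = ∫ |v0^S|² dμ0 + (κ²/4) ∫ (α0^S)² dμ0 + κ² (μ1^S)^⊥(ℝ^n). -/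
open MeasureTheory ENNReal Filter Topology RealInnerProductSpace
open scoped Classical

noncomputable section

abbrev Eucl (n : ℕ) : Type := EuclideanSpace ℝ (Fin n)

/-- Truncated cosine `Cos`. -/
def truncCos (s : ℝ) : ℝ := Real.cos (min |s| (Real.pi / 2))

/-- The Hellinger–Kantorovich cost function `c_κ`. -/
def cHK {n : ℕ} (κ : ℝ) (x y : Eucl n) : ℝ≥0∞ :=
  if dist x y < κ * Real.pi / 2 then
    ENNReal.ofReal (-2 * κ ^ 2 * Real.log (Real.cos (dist x y / κ)))
  else ⊤

/-- Kullback–Leibler divergence `KL(ρ|μ)`. -/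
def KLdiv {α : Type*} [MeasurableSpace α] (ρ μ : Measure α) : ℝ≥0∞ :=
  if ρ ≪ μ then
    ∫⁻ x, ENNReal.ofReal ((ρ.rnDeriv μ x).toReal * Real.log (ρ.rnDeriv μ x).toReal
      - (ρ.rnDeriv μ x).toReal + 1) ∂μ
  else ⊤

/-- The soft-marginal Hellinger–Kantorovich functional `E_κ(π|μ0,μ1)`. -/
def HKfun {n : ℕ} (κ : ℝ) (π : Measure (Eucl n × Eucl n)) (μ0 μ1 : Measure (Eucl n)) : ℝ≥0∞ :=
  ∫⁻ p, cHK κ p.1 p.2 ∂π + ENNReal.ofReal (κ ^ 2) * KLdiv (π.map Prod.fst) μ0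
    + ENNReal.ofReal (κ ^ 2) * KLdiv (π.map Prod.snd) μ1

/-- The squared Hellinger–Kantorovich distance `HK_κ²(μ0,μ1)`. -/
def HK2 {n : ℕ} (κ : ℝ) (μ0 μ1 : Measure (Eucl n)) : ℝ≥0∞ :=
  ⨅ (π : Measure (Eucl n × Eucl n)) (_ : IsFiniteMeasure π), HKfun κ π μ0 μ1

/-- The squared 2-Wasserstein distance `W2²(μ0,μ1)`. -/
def W2sq {n : ℕ} (μ0 μ1 : Measure (Eucl n)) : ℝ≥0∞ :=
  ⨅ (π : Measure (Eucl n × Eucl n))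
    (_ : π.map Prod.fst = μ0 ∧ π.map Prod.snd = μ1),
      ∫⁻ p, ENNReal.ofReal (dist p.1 p.2 ^ 2) ∂π

/-- Narrow convergence of a sequence of measures. -/
def NarrowTendsto {α : Type*} [MeasurableSpace α] [TopologicalSpace α]
    (ρ : ℕ → Measure α) (ρlim : Measure α) : Prop :=
  ∀ φ : BoundedContinuousFunction α ℝ,
    Tendsto (fun N => ∫ x, φ x ∂(ρ N)) atTop (𝓝 (∫ x, φ x ∂ρlim))

/-- The spherical Hellinger–Kantorovich distance `SHK_κ(μ0,μ1)`. -/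
def SHK {n : ℕ} (κ : ℝ) (μ0 μ1 : Measure (Eucl n)) : ℝ :=
  κ * Real.arccos (1 - (HK2 κ μ0 μ1).toReal / (2 * κ ^ 2))

/-- The square-root measure `√(ρσ)`. -/
def sqrtMeasure {α : Type*} [MeasurableSpace α] (ρ σ : Measure α) : Measure α :=
  (ρ + σ).withDensity (fun x => (ρ.rnDeriv (ρ + σ) x * σ.rnDeriv (ρ + σ) x) ^ (1/2 : ℝ))



/-- barycentric HK velocity. -/
def barV {n : ℕ} (κ : ℝ) (μ0 : Measure (Eucl n)) (π : Measure (Eucl n × Eucl n))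
    [IsFiniteMeasure π] (x : Eucl n) : Eucl n :=
  (κ * ((π.map Prod.fst).rnDeriv μ0 x).toReal) •
    ∫ y, (Real.tan (‖y - x‖ / κ) / ‖y - x‖) • (y - x) ∂(π.condKernel x)

/-- barycentric HK growth. -/
def barA {n : ℕ} (μ0 : Measure (Eucl n)) (π : Measure (Eucl n × Eucl n)) (x : Eucl n) : ℝ :=
  2 * (((π.map Prod.fst).rnDeriv μ0 x).toReal - 1)

/-- barycentric W2 velocity. -/
def barW {n : ℕ} (π : Measure (Eucl n × Eucl n)) [IsFiniteMeasure π] (x : Eucl n) : Eucl n :=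
  ∫ y, (y - x) ∂(π.condKernel x)

end

open InformationTheory in
lemma KLdiv_eq_klDiv {α : Type*} [MeasurableSpace α] (ρ μ : Measure α)
    [IsFiniteMeasure ρ] [IsFiniteMeasure μ] : KLdiv ρ μ = klDiv ρ μ := by
  rw [klDiv_eq_lintegral_klFun, KLdiv]
  congr 1
  refine lintegral_congr fun x => ?_
  rw [klFun_apply]
  ring_nf

open InformationTheory in
lemma klFun_add_mul_le {a b t : ℝ} (ha : 0 ≤ a) (hb : 0 ≤ b) (ht : 0 < t) :
    klFun (b + t * a) ≤ klFun (b + a) + (t - 1) * (a * Real.log (b + a)) + (t - 1) ^ 2 * a := by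
  rcases ha.eq_or_lt with rfl | ha
  · simp
  have hz : 0 < b + a := by positivity
  have hw : 0 < b + t * a := by positivity
  have hlog : Real.log (b + t * a) ≤ Real.log (b + a) + ((b + t * a) / (b + a) - 1) := by
    have h := Real.log_le_sub_one_of_pos (div_pos hw hz)
    rw [Real.log_div hw.ne' hz.ne'] at h
    linarith
  have hquad : (b + t * a) * ((b + t * a) / (b + a) - 1)
      = (t - 1) * a + (t - 1) ^ 2 * (a * (a / (b + a))) := by
    field_simp
    ring
  have hfrac : a * (a / (b + a)) ≤ a :=
    mul_le_of_le_one_right ha.le ((div_le_one hz).2 (by linarith))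
  have hmul := mul_le_mul_of_nonneg_left hlog hw.le
  have hsq := mul_le_mul_of_nonneg_left hfrac (sq_nonneg (t - 1))
  simp only [klFun_apply]
  linear_combination hmul + hquad + hsq

open InformationTheory in
/-- Quadratic upper bound for the Kullback–Leibler divergence when a part of the first measure
is rescaled. -/
lemma klDiv_add_smul_le {α : Type*} [MeasurableSpace α] (ρA ρB μ : Measure α)
    [IsFiniteMeasure ρA] [IsFiniteMeasure ρB] [IsFiniteMeasure μ]
    (h : klDiv (ρB + ρA) μ ≠ ⊤) (t : NNReal) (ht : 0 < t) :
    klDiv (ρB + t • ρA) μ ≠ ⊤ ∧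
    (klDiv (ρB + t • ρA) μ).toReal ≤ (klDiv (ρB + ρA) μ).toReal
      + ((t : ℝ) - 1) * ∫ x, llr (ρB + ρA) μ x ∂ρA + ((t : ℝ) - 1) ^ 2 * ρA.real Set.univ := by
  obtain ⟨hac, hllr⟩ := klDiv_ne_top_iff.1 h
  have hacA : ρA ≪ μ := (Measure.le_add_left le_rfl).absolutelyContinuous.trans hac
  have hacB : ρB ≪ μ := (Measure.le_add_right le_rfl).absolutelyContinuous.trans hac
  have hact : ρB + t • ρA ≪ μ := by
    refine Measure.AbsolutelyContinuous.add_left hacB (hacA.smul_left t)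
  have hintA : Integrable (llr (ρB + ρA) μ) ρA := hllr.mono_measure (Measure.le_add_left le_rfl)
  have hd : (ρB + ρA).rnDeriv μ =ᵐ[μ] ρB.rnDeriv μ + ρA.rnDeriv μ := Measure.rnDeriv_add' _ _ _
  have hdt : (ρB + t • ρA).rnDeriv μ =ᵐ[μ] ρB.rnDeriv μ + t • ρA.rnDeriv μ :=
    (Measure.rnDeriv_add' _ _ _).trans
      (EventuallyEq.rfl.add (Measure.rnDeriv_smul_left ρA μ t))
  set g : α → ℝ := fun x => klFun ((ρB + ρA).rnDeriv μ x).toReal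
    + ((t : ℝ) - 1) * ((ρA.rnDeriv μ x).toReal * llr (ρB + ρA) μ x)
    + ((t : ℝ) - 1) ^ 2 * (ρA.rnDeriv μ x).toReal with hg
  have i1 : Integrable (fun x => klFun ((ρB + ρA).rnDeriv μ x).toReal) μ :=
    (integrable_klFun_rnDeriv_iff hac).2 hllr
  have i2 : Integrable (fun x => (ρA.rnDeriv μ x).toReal * llr (ρB + ρA) μ x) μ :=
    (integrable_toReal_rnDeriv_mul_iff hacA).2 hintA
  have i3 : Integrable (fun x => (ρA.rnDeriv μ x).toReal) μ := Measure.integrable_toReal_rnDeriv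
  have i12 : Integrable (fun x => klFun ((ρB + ρA).rnDeriv μ x).toReal
      + ((t : ℝ) - 1) * ((ρA.rnDeriv μ x).toReal * llr (ρB + ρA) μ x)) μ := i1.add (i2.const_mul _)
  have hgi : Integrable g μ := i12.add (i3.const_mul _)
  have hle : ∀ᵐ x ∂μ, klFun ((ρB + t • ρA).rnDeriv μ x).toReal ≤ g x := by
    filter_upwards [hd, hdt, Measure.rnDeriv_lt_top ρA μ, Measure.rnDeriv_lt_top ρB μ]
      with x h1 h2 h3 h4
    simp only [hg, llr]
    rw [h1, h2]
    simp only [Pi.add_apply, Pi.smul_apply, ENNReal.smul_def, smul_eq_mul]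
    rw [ENNReal.toReal_add h4.ne (ENNReal.mul_ne_top coe_ne_top h3.ne),
      ENNReal.toReal_add h4.ne h3.ne, ENNReal.toReal_mul, ENNReal.coe_toReal]
    exact klFun_add_mul_le toReal_nonneg toReal_nonneg (by exact_mod_cast ht)
  have hg0 : 0 ≤ᵐ[μ] g := hle.mono fun x hx => (klFun_nonneg toReal_nonneg).trans hx
  have hbound : klDiv (ρB + t • ρA) μ ≤ ENNReal.ofReal (∫ x, g x ∂μ) := by
    rw [klDiv_eq_lintegral_klFun_of_ac hact, ofReal_integral_eq_lintegral_ofReal hgi hg0]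
    exact lintegral_mono_ae (hle.mono fun x hx => ENNReal.ofReal_le_ofReal hx)
  have hgval : ∫ x, g x ∂μ = (klDiv (ρB + ρA) μ).toReal
      + ((t : ℝ) - 1) * ∫ x, llr (ρB + ρA) μ x ∂ρA + ((t : ℝ) - 1) ^ 2 * ρA.real Set.univ := by
    rw [hg, integral_add i12 (i3.const_mul _),
      integral_add i1 (i2.const_mul _), integral_const_mul, integral_const_mul,
      integral_toReal_rnDeriv_mul hacA, Measure.integral_toReal_rnDeriv hacA,
      toReal_klDiv_eq_integral_klFun hac]
  rw [← hgval]
  exact ⟨(hbound.trans_lt ofReal_lt_top).ne,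
    ENNReal.toReal_le_of_le_ofReal (integral_nonneg_of_ae hg0) hbound⟩

lemma eq_zero_of_forall_le_quadratic {S C : ℝ}
    (h : ∀ t : NNReal, 0 < t → 0 ≤ ((t : ℝ) - 1) * S + ((t : ℝ) - 1) ^ 2 * C) : S = 0 := by
  by_contra hS
  have hSpos : 0 < |S| := abs_pos.2 hS
  set D := |S| + |C| + 1 with hD
  have hDpos : 0 < D := by positivity
  set e : ℝ := -S / (2 * D) with he
  have he1 : -(1 / 2) ≤ e := by
    rw [he, le_div_iff₀ (by positivity)]
    nlinarith [le_abs_self S, abs_nonneg C]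
  have ht : (0 : ℝ) < 1 + e := by linarith
  have := h ⟨1 + e, ht.le⟩ (by exact_mod_cast ht)
  change 0 ≤ ((1 + e) - 1) * S + ((1 + e) - 1) ^ 2 * C at this
  rw [add_sub_cancel_left] at this
  have h1 : e * S + e ^ 2 * C = S ^ 2 / (4 * D ^ 2) * (C - 2 * D) := by
    rw [he]; field_simp; ring
  rw [h1] at this
  have h2 : 0 < S ^ 2 / (4 * D ^ 2) := by positivity
  have h3 : C - 2 * D < 0 := by nlinarith [le_abs_self C, abs_nonneg C]
  nlinarith [mul_neg_of_pos_of_neg h2 h3]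

lemma ae_singularPart_rnDeriv_eq_zero {α : Type*} [MeasurableSpace α] (μ ρ : Measure α)
    [IsFiniteMeasure μ] [IsFiniteMeasure ρ] :
    ∀ᵐ x ∂(μ.singularPart ρ), ρ.rnDeriv μ x = 0 :=
  Measure.rnDeriv_eq_zero_of_mutuallySingular (Measure.mutuallySingular_singularPart μ ρ).symm
    (Measure.singularPart_le μ ρ).absolutelyContinuous

lemma ae_of_ae_of_ae_singularPart {α : Type*} [MeasurableSpace α] {μ ρ : Measure α}
    [IsFiniteMeasure μ] [IsFiniteMeasure ρ] {p : α → Prop}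
    (h1 : ∀ᵐ x ∂ρ, p x) (h2 : ∀ᵐ x ∂(μ.singularPart ρ), p x) : ∀ᵐ x ∂μ, p x := by
  rw [← Measure.singularPart_add_rnDeriv μ ρ, ae_add_measure_iff]
  exact ⟨h2, (withDensity_absolutelyContinuous ρ _).ae_le h1⟩

lemma singularPart_univ_eq {α : Type*} [MeasurableSpace α] {μ ρ : Measure α}
    [IsFiniteMeasure μ] [IsFiniteMeasure ρ] (h : ρ ≪ μ) :
    μ.singularPart ρ Set.univ = μ {x | ρ.rnDeriv μ x = 0} := by
  have hρ : ρ {x | ρ.rnDeriv μ x = 0} = 0 := by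
    refine measure_mono_null ?_ (ae_iff.1 (Measure.rnDeriv_pos h))
    intro x hx
    simpa using hx
  have hw : (ρ.withDensity (μ.rnDeriv ρ)) {x | ρ.rnDeriv μ x = 0} = 0 :=
    withDensity_absolutelyContinuous ρ _ hρ
  have hs : μ.singularPart ρ {x | ρ.rnDeriv μ x = 0} = μ.singularPart ρ Set.univ := by
    refine measure_congr ?_
    filter_upwards [ae_singularPart_rnDeriv_eq_zero μ ρ] with x hx
    exact propext ⟨fun _ => trivial, fun _ => hx⟩
  have hdec := congrArg (fun m : Measure α => m {x | ρ.rnDeriv μ x = 0})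
    (Measure.singularPart_add_rnDeriv μ ρ)
  rw [← hdec]
  simp only [Measure.add_apply]
  rw [hw, add_zero, hs]

lemma measurable_cHK {n : ℕ} (κ : ℝ) :
    Measurable fun p : Eucl n × Eucl n => cHK κ p.1 p.2 := by
  unfold cHK
  refine Measurable.ite (measurableSet_lt (by fun_prop) (by fun_prop)) ?_ measurable_const
  have hd : Measurable fun p : Eucl n × Eucl n => dist p.1 p.2 := by fun_prop
  exact ENNReal.measurable_ofReal.comp ((Real.measurable_log.comp
    (Real.measurable_cos.comp (hd.div_const κ))).const_mul _)

open InformationTheory in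
lemma HKfun_ne_top_iff {n : ℕ} {κ : ℝ} (hκ : 0 < κ) (π : Measure (Eucl n × Eucl n))
    [IsFiniteMeasure π] (μ0 μ1 : Measure (Eucl n)) [IsFiniteMeasure μ0] [IsFiniteMeasure μ1] :
    HKfun κ π μ0 μ1 ≠ ⊤ ↔ ∫⁻ p, cHK κ p.1 p.2 ∂π ≠ ⊤ ∧ klDiv (π.map Prod.fst) μ0 ≠ ⊤ ∧
      klDiv (π.map Prod.snd) μ1 ≠ ⊤ := by
  rw [HKfun, KLdiv_eq_klDiv, KLdiv_eq_klDiv]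
  simp [ENNReal.add_eq_top, ENNReal.mul_eq_top, hκ.ne', and_assoc]

open InformationTheory in
lemma toReal_HKfun {n : ℕ} {κ : ℝ} (hκ : 0 < κ) (π : Measure (Eucl n × Eucl n))
    [IsFiniteMeasure π] (μ0 μ1 : Measure (Eucl n)) [IsFiniteMeasure μ0] [IsFiniteMeasure μ1]
    (h : HKfun κ π μ0 μ1 ≠ ⊤) :
    (HKfun κ π μ0 μ1).toReal = (∫⁻ p, cHK κ p.1 p.2 ∂π).toReal
      + κ ^ 2 * (klDiv (π.map Prod.fst) μ0).toReal
      + κ ^ 2 * (klDiv (π.map Prod.snd) μ1).toReal := by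
  obtain ⟨h1, h2, h3⟩ := (HKfun_ne_top_iff hκ π μ0 μ1).1 h
  have h2' := ENNReal.mul_ne_top (ofReal_ne_top (r := κ ^ 2)) h2
  have h3' := ENNReal.mul_ne_top (ofReal_ne_top (r := κ ^ 2)) h3
  rw [HKfun, KLdiv_eq_klDiv, KLdiv_eq_klDiv,
    ENNReal.toReal_add (ENNReal.add_ne_top.2 ⟨h1, h2'⟩) h3', ENNReal.toReal_add h1 h2',
    ENNReal.toReal_mul, ENNReal.toReal_mul, ENNReal.toReal_ofReal (sq_nonneg κ)]

lemma integrable_toReal_cHK {n : ℕ} {κ : ℝ} {π : Measure (Eucl n × Eucl n)}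
    (h : ∫⁻ p, cHK κ p.1 p.2 ∂π ≠ ⊤) : Integrable (fun p => (cHK κ p.1 p.2).toReal) π :=
  integrable_toReal_of_lintegral_ne_top (measurable_cHK κ).aemeasurable h

lemma toReal_lintegral_cHK {n : ℕ} {κ : ℝ} {π : Measure (Eucl n × Eucl n)}
    (h : ∫⁻ p, cHK κ p.1 p.2 ∂π ≠ ⊤) :
    (∫⁻ p, cHK κ p.1 p.2 ∂π).toReal = ∫ p, (cHK κ p.1 p.2).toReal ∂π :=
  (integral_toReal (measurable_cHK κ).aemeasurable (ae_lt_top (measurable_cHK κ) h)).symm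

open InformationTheory in
lemma integrable_llr_fst {α β : Type*} [MeasurableSpace α] [MeasurableSpace β]
    {π : Measure (α × β)} {μ : Measure α} (h : klDiv (π.map Prod.fst) μ ≠ ⊤) :
    Integrable (fun p => llr (π.map Prod.fst) μ p.1) π :=
  (klDiv_ne_top_iff.1 h).2.comp_measurable measurable_fst

open InformationTheory in
lemma integrable_llr_snd {α β : Type*} [MeasurableSpace α] [MeasurableSpace β]
    {π : Measure (α × β)} {μ : Measure β} (h : klDiv (π.map Prod.snd) μ ≠ ⊤) :
    Integrable (fun p => llr (π.map Prod.snd) μ p.2) π :=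
  (klDiv_ne_top_iff.1 h).2.comp_measurable measurable_snd

open InformationTheory in
/-- First-order optimality condition for minimizers of the Hellinger–Kantorovich functional. -/
lemma HKfun_first_order_condition {n : ℕ} {κ : ℝ} (hκ : 0 < κ) (π : Measure (Eucl n × Eucl n))
    [IsFiniteMeasure π] (μ0 μ1 : Measure (Eucl n)) [IsFiniteMeasure μ0] [IsFiniteMeasure μ1]
    (hfin : HKfun κ π μ0 μ1 ≠ ⊤)
    (hopt : ∀ π' : Measure (Eucl n × Eucl n), IsFiniteMeasure π' →
      HKfun κ π μ0 μ1 ≤ HKfun κ π' μ0 μ1) :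
    ∀ᵐ p ∂π, (cHK κ p.1 p.2).toReal + κ ^ 2 * llr (π.map Prod.fst) μ0 p.1
      + κ ^ 2 * llr (π.map Prod.snd) μ1 p.2 = 0 := by
  obtain ⟨hc, h0, h1⟩ := (HKfun_ne_top_iff hκ π μ0 μ1).1 hfin
  have ic := integrable_toReal_cHK hc
  have i0 := (integrable_llr_fst h0).const_mul (κ ^ 2)
  have i1 := (integrable_llr_snd h1).const_mul (κ ^ 2)
  have ic0 : Integrable (fun p => (cHK κ p.1 p.2).toReal
    + κ ^ 2 * llr (π.map Prod.fst) μ0 p.1) π := ic.add i0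
  refine Integrable.ae_eq_zero_of_forall_setIntegral_eq_zero (ic0.add i1) ?_
  intro A hA _
  rw [integral_add ic0.integrableOn i1.integrableOn,
    integral_add ic.integrableOn i0.integrableOn, integral_const_mul, integral_const_mul]
  refine eq_zero_of_forall_le_quadratic (C := 2 * κ ^ 2 * (π.restrict A).real Set.univ) ?_
  intro t ht
  set πA := π.restrict A
  set πB := π.restrict Aᶜ
  have hdec : πB + πA = π := by
    rw [add_comm]; exact Measure.restrict_add_restrict_compl hA
  have hf : πB.map Prod.fst + πA.map Prod.fst = π.map Prod.fst := by
    rw [← Measure.map_add _ _ measurable_fst, hdec]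
  have hs : πB.map Prod.snd + πA.map Prod.snd = π.map Prod.snd := by
    rw [← Measure.map_add _ _ measurable_snd, hdec]
  have hft : (πB + t • πA).map Prod.fst = πB.map Prod.fst + t • πA.map Prod.fst := by
    rw [Measure.map_add _ _ measurable_fst, Measure.map_smul]
  have hst : (πB + t • πA).map Prod.snd = πB.map Prod.snd + t • πA.map Prod.snd := by
    rw [Measure.map_add _ _ measurable_snd, Measure.map_smul]
  obtain ⟨k0, k0'⟩ := klDiv_add_smul_le (πA.map Prod.fst) (πB.map Prod.fst) μ0 (by rwa [hf]) t ht
  obtain ⟨k1, k1'⟩ := klDiv_add_smul_le (πA.map Prod.snd) (πB.map Prod.snd) μ1 (by rwa [hs]) t ht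
  rw [← hft] at k0 k0'
  rw [← hst] at k1 k1'
  rw [hf, integral_map measurable_fst.aemeasurable
    (stronglyMeasurable_llr _ _).aestronglyMeasurable,
    map_measureReal_apply measurable_fst MeasurableSet.univ, Set.preimage_univ] at k0'
  rw [hs, integral_map measurable_snd.aemeasurable
    (stronglyMeasurable_llr _ _).aestronglyMeasurable,
    map_measureReal_apply measurable_snd MeasurableSet.univ, Set.preimage_univ] at k1'
  have hcA : ∫⁻ p, cHK κ p.1 p.2 ∂πA ≠ ⊤ :=
    ((lintegral_mono' Measure.restrict_le_self le_rfl).trans_lt hc.lt_top).ne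
  have hcB : ∫⁻ p, cHK κ p.1 p.2 ∂πB ≠ ⊤ :=
    ((lintegral_mono' Measure.restrict_le_self le_rfl).trans_lt hc.lt_top).ne
  have hct : ∫⁻ p, cHK κ p.1 p.2 ∂(πB + t • πA)
      = ∫⁻ p, cHK κ p.1 p.2 ∂πB + t * ∫⁻ p, cHK κ p.1 p.2 ∂πA := by
    rw [lintegral_add_measure, lintegral_smul_measure]
    rfl
  have hct' : ∫⁻ p, cHK κ p.1 p.2 ∂(πB + t • πA) ≠ ⊤ := by
    rw [hct]
    exact ENNReal.add_ne_top.2 ⟨hcB, ENNReal.mul_ne_top coe_ne_top hcA⟩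
  have hc1 : (∫⁻ p, cHK κ p.1 p.2 ∂π).toReal = (∫⁻ p, cHK κ p.1 p.2 ∂πB).toReal
      + (∫⁻ p, cHK κ p.1 p.2 ∂πA).toReal := by
    rw [← ENNReal.toReal_add hcB hcA, ← lintegral_add_measure, hdec]
  have hct1 : (∫⁻ p, cHK κ p.1 p.2 ∂(πB + t • πA)).toReal = (∫⁻ p, cHK κ p.1 p.2 ∂πB).toReal
      + t * (∫⁻ p, cHK κ p.1 p.2 ∂πA).toReal := by
    rw [hct, ENNReal.toReal_add hcB (ENNReal.mul_ne_top coe_ne_top hcA), ENNReal.toReal_mul,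
      ENNReal.coe_toReal]
  have hfint := (HKfun_ne_top_iff hκ (πB + t • πA) μ0 μ1).2 ⟨hct', k0, k1⟩
  have hle := ENNReal.toReal_mono hfint (hopt (πB + t • πA) inferInstance)
  rw [toReal_HKfun hκ _ _ _ hfin, toReal_HKfun hκ _ _ _ hfint, hc1, hct1,
    toReal_lintegral_cHK hcA] at hle
  have e0 := mul_le_mul_of_nonneg_left k0' (sq_nonneg κ)
  have e1 := mul_le_mul_of_nonneg_left k1' (sq_nonneg κ)
  linarith

/-- At a minimizer the Hellinger–Kantorovich functional is determined by the total mass. -/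
lemma toReal_HKfun_of_first_order {n : ℕ} {κ : ℝ} (hκ : 0 < κ) (π : Measure (Eucl n × Eucl n))
    [IsFiniteMeasure π] (μ0 μ1 : Measure (Eucl n)) [IsProbabilityMeasure μ0]
    [IsProbabilityMeasure μ1] (hfin : HKfun κ π μ0 μ1 ≠ ⊤)
    (hfoc : ∀ᵐ p ∂π, (cHK κ p.1 p.2).toReal + κ ^ 2 * llr (π.map Prod.fst) μ0 p.1
      + κ ^ 2 * llr (π.map Prod.snd) μ1 p.2 = 0) :
    (HKfun κ π μ0 μ1).toReal = 2 * κ ^ 2 * (1 - π.real Set.univ) := by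
  obtain ⟨hc, h0, h1⟩ := (HKfun_ne_top_iff hκ π μ0 μ1).1 hfin
  have ic := integrable_toReal_cHK hc
  have i0 := (integrable_llr_fst h0).const_mul (κ ^ 2)
  have i1 := (integrable_llr_snd h1).const_mul (κ ^ 2)
  have ic0 : Integrable (fun p => (cHK κ p.1 p.2).toReal
    + κ ^ 2 * llr (π.map Prod.fst) μ0 p.1) π := ic.add i0
  have hllr := integral_congr_ae hfoc
  rw [integral_zero, integral_add ic0 i1, integral_add ic i0, integral_const_mul,
    integral_const_mul] at hllr
  obtain ⟨a0, b0⟩ := InformationTheory.klDiv_ne_top_iff.1 h0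
  obtain ⟨a1, b1⟩ := InformationTheory.klDiv_ne_top_iff.1 h1
  rw [toReal_HKfun hκ _ _ _ hfin, InformationTheory.toReal_klDiv a0 b0,
    InformationTheory.toReal_klDiv a1 b1, toReal_lintegral_cHK hc,
    integral_map measurable_fst.aemeasurable (stronglyMeasurable_llr _ _).aestronglyMeasurable,
    map_measureReal_apply measurable_fst MeasurableSet.univ, Set.preimage_univ,
    integral_map measurable_snd.aemeasurable (stronglyMeasurable_llr _ _).aestronglyMeasurable,
    map_measureReal_apply measurable_snd MeasurableSet.univ, Set.preimage_univ,
    probReal_univ (μ := μ0), probReal_univ (μ := μ1)]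
  linarith

lemma HK2_le_two_mul_sq {n : ℕ} (κ : ℝ) (μ0 μ1 : Measure (Eucl n)) [IsProbabilityMeasure μ0]
    [IsProbabilityMeasure μ1] : HK2 κ μ0 μ1 ≤ ENNReal.ofReal (2 * κ ^ 2) := by
  refine (iInf₂_le (0 : Measure (Eucl n × Eucl n)) isFiniteMeasureZero).trans (le_of_eq ?_)
  rw [HKfun, KLdiv_eq_klDiv, KLdiv_eq_klDiv, two_mul,
    ENNReal.ofReal_add (sq_nonneg κ) (sq_nonneg κ)]
  simp

lemma one_add_tan_sq_eq_inv_mul {κ r a b : ℝ} (hκ : 0 < κ) (hr0 : 0 ≤ r)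
    (hr : r < κ * Real.pi / 2) (ha : 0 < a) (hb : 0 < b)
    (h : -2 * κ ^ 2 * Real.log (Real.cos (r / κ)) + κ ^ 2 * Real.log a + κ ^ 2 * Real.log b = 0) :
    1 + Real.tan (r / κ) ^ 2 = (a * b)⁻¹ := by
  have hcos : 0 < Real.cos (r / κ) := by
    refine Real.cos_pos_of_mem_Ioo ⟨?_, ?_⟩
    · have : 0 ≤ r / κ := by positivity
      linarith [Real.pi_pos]
    · rw [div_lt_iff₀ hκ]
      linarith
  have hlog : Real.log (a * b) = Real.log (Real.cos (r / κ) ^ 2) := by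
    rw [Real.log_mul ha.ne' hb.ne', Real.log_pow]
    refine mul_left_cancel₀ (pow_pos hκ 2).ne' ?_
    push_cast
    linarith
  have hab := Real.log_injOn_pos (Set.mem_Ioi.2 (mul_pos ha hb)) (Set.mem_Ioi.2 (pow_pos hcos 2)) hlog
  rw [hab, ← Real.inv_one_add_tan_sq hcos.ne', inv_inv]

lemma cHK_lt_top_iff {n : ℕ} {κ : ℝ} {x y : Eucl n} :
    cHK κ x y < ⊤ ↔ dist x y < κ * Real.pi / 2 := by
  unfold cHK
  split_ifs with h <;> simp [h]

lemma toReal_cHK {n : ℕ} {κ : ℝ} (hκ : 0 < κ) {x y : Eucl n} (h : dist x y < κ * Real.pi / 2) :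
    (cHK κ x y).toReal = -2 * κ ^ 2 * Real.log (Real.cos (dist x y / κ)) := by
  rw [cHK, if_pos h, ENNReal.toReal_ofReal]
  have hcos : 0 ≤ Real.cos (dist x y / κ) := by
    refine Real.cos_nonneg_of_mem_Icc ⟨?_, ?_⟩
    · have : 0 ≤ dist x y / κ := by positivity
      linarith [Real.pi_pos]
    · rw [div_le_iff₀ hκ]
      linarith
  nlinarith [Real.log_nonpos hcos (Real.cos_le_one _), sq_nonneg κ]

/-- Density form of the optimality condition for a deterministic minimizer. -/
lemma ae_sq_mul_one_add_tan_sq_eq {n : ℕ} {κ : ℝ} (hκ : 0 < κ) (π : Measure (Eucl n × Eucl n))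
    [IsFiniteMeasure π] (μ0 μ1 : Measure (Eucl n)) [IsFiniteMeasure μ0] [IsFiniteMeasure μ1]
    (hfin : HKfun κ π μ0 μ1 ≠ ⊤)
    (hfoc : ∀ᵐ p ∂π, (cHK κ p.1 p.2).toReal + κ ^ 2 * llr (π.map Prod.fst) μ0 p.1
      + κ ^ 2 * llr (π.map Prod.snd) μ1 p.2 = 0)
    (T : Eucl n → Eucl n) (hT : Measurable T)
    (hπT : π = (π.map Prod.fst).map (fun x => (x, T x))) :
    ∀ᵐ x ∂μ0, ((π.map Prod.fst).rnDeriv μ0 x).toReal ^ 2 * (1 + Real.tan (‖T x - x‖ / κ) ^ 2)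
      = ((π.map Prod.fst).rnDeriv μ0 x).toReal
        * (((π.map Prod.snd).rnDeriv μ1 (T x)).toReal)⁻¹ := by
  obtain ⟨hc, h0, h1⟩ := (HKfun_ne_top_iff hκ π μ0 μ1).1 hfin
  have a0 := (InformationTheory.klDiv_ne_top_iff.1 h0).1
  have a1 := (InformationTheory.klDiv_ne_top_iff.1 h1).1
  have hall : ∀ᵐ p ∂π, ((π.map Prod.fst).rnDeriv μ0 p.1).toReal ^ 2
      * (1 + Real.tan (‖p.2 - p.1‖ / κ) ^ 2)
      = ((π.map Prod.fst).rnDeriv μ0 p.1).toReal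
        * (((π.map Prod.snd).rnDeriv μ1 p.2).toReal)⁻¹ := by
    filter_upwards [hfoc, ae_lt_top (measurable_cHK κ) hc,
      ae_of_ae_map measurable_fst.aemeasurable (Measure.rnDeriv_pos a0),
      ae_of_ae_map measurable_snd.aemeasurable (Measure.rnDeriv_pos a1),
      ae_of_ae_map measurable_fst.aemeasurable (a0.ae_le (Measure.rnDeriv_lt_top (π.map Prod.fst) μ0)),
      ae_of_ae_map measurable_snd.aemeasurable (a1.ae_le (Measure.rnDeriv_lt_top (π.map Prod.snd) μ1))]
      with p hp hd p0 p1 t0 t1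
    have hd' := cHK_lt_top_iff.1 hd
    have hpos0 := ENNReal.toReal_pos p0.ne' t0.ne
    have hpos1 := ENNReal.toReal_pos p1.ne' t1.ne
    rw [toReal_cHK hκ hd'] at hp
    have key := one_add_tan_sq_eq_inv_mul hκ dist_nonneg hd' hpos0 hpos1 hp
    rw [dist_comm, dist_eq_norm] at key
    rw [key]
    field_simp
  refine ae_of_ae_of_ae_singularPart (ρ := π.map Prod.fst) ?_ ?_
  · rw [hπT] at hall
    have := ae_of_ae_map (by fun_prop) hall
    rwa [← hπT] at this
  · filter_upwards [ae_singularPart_rnDeriv_eq_zero μ0 (π.map Prod.fst)] with x hx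
    simp [hx]

lemma integrable_inv_toReal_rnDeriv {α : Type*} [MeasurableSpace α] {ρ μ : Measure α}
    [IsFiniteMeasure ρ] [IsFiniteMeasure μ] (h : ρ ≪ μ) :
    Integrable (fun x => ((ρ.rnDeriv μ x).toReal)⁻¹) ρ ∧
      ∫ x, ((ρ.rnDeriv μ x).toReal)⁻¹ ∂ρ = μ.real {x | ρ.rnDeriv μ x ≠ 0} := by
  have hm : MeasurableSet {x | ρ.rnDeriv μ x ≠ 0} :=
    (Measure.measurable_rnDeriv ρ μ (measurableSet_singleton 0)).compl
  have hae : (fun x => (ρ.rnDeriv μ x).toReal * ((ρ.rnDeriv μ x).toReal)⁻¹)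
      =ᵐ[μ] {x | ρ.rnDeriv μ x ≠ 0}.indicator 1 := by
    filter_upwards [Measure.rnDeriv_lt_top ρ μ] with x hx
    by_cases h0 : ρ.rnDeriv μ x = 0
    · simp [h0]
    · simp [h0, mul_inv_cancel₀ (ENNReal.toReal_pos h0 hx.ne).ne']
  constructor
  · rw [← integrable_toReal_rnDeriv_mul_iff h, integrable_congr hae]
    exact (integrable_const (1 : ℝ)).indicator hm
  · rw [← integral_toReal_rnDeriv_mul h, integral_congr_ae hae, integral_indicator_one hm]

lemma integral_rnDeriv_mul_inv_comp {n : ℕ} (π : Measure (Eucl n × Eucl n))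
    [IsFiniteMeasure π] (μ0 μ1 : Measure (Eucl n)) [IsFiniteMeasure μ0] [IsFiniteMeasure μ1]
    (h0 : π.map Prod.fst ≪ μ0) (h1 : π.map Prod.snd ≪ μ1)
    (T : Eucl n → Eucl n) (hT : Measurable T)
    (hπT : π = (π.map Prod.fst).map (fun x => (x, T x))) :
    Integrable (fun x => ((π.map Prod.fst).rnDeriv μ0 x).toReal
      * (((π.map Prod.snd).rnDeriv μ1 (T x)).toReal)⁻¹) μ0 ∧
    ∫ x, ((π.map Prod.fst).rnDeriv μ0 x).toReal
      * (((π.map Prod.snd).rnDeriv μ1 (T x)).toReal)⁻¹ ∂μ0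
      = μ1.real {y | (π.map Prod.snd).rnDeriv μ1 y ≠ 0} := by
  have hsnd : (π.map Prod.fst).map T = π.map Prod.snd := by
    conv_rhs => rw [hπT]
    rw [Measure.map_map measurable_snd (by fun_prop)]
    rfl
  obtain ⟨hi, hv⟩ := integrable_inv_toReal_rnDeriv h1
  have hmeas : Measurable fun y => (((π.map Prod.snd).rnDeriv μ1 y).toReal)⁻¹ :=
    (Measure.measurable_rnDeriv _ _).ennreal_toReal.inv
  constructor
  · rw [integrable_toReal_rnDeriv_mul_iff h0]
    rw [← hsnd] at hi
    have := hi.comp_measurable hT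
    rwa [hsnd] at this
  · rw [integral_toReal_rnDeriv_mul h0, ← hv]
    conv_rhs => rw [← hsnd]
    rw [integral_map hT.aemeasurable (hsnd ▸ hmeas.aestronglyMeasurable)]
    rw [hsnd]

lemma lintegral_ofReal_eq_ofReal_const_mul_integral {α : Type*} [MeasurableSpace α]
    {μ : Measure α} {f g : α → ℝ} {c : ℝ} (hg : Integrable g μ) (hf : ∀ x, 0 ≤ f x)
    (hfg : ∀ᵐ x ∂μ, f x = c * g x) :
    ∫⁻ x, ENNReal.ofReal (f x) ∂μ = ENNReal.ofReal (c * ∫ x, g x ∂μ) := by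
  rw [← integral_const_mul, ← integral_congr_ae hfg, ofReal_integral_eq_lintegral_ofReal
    ((hg.const_mul c).congr (hfg.mono fun x hx => hx.symm)) (ae_of_all _ hf)]

/-- `SHK_κ²(μ0,μ1)` as the squared norm of the SHK logarithmic map. -/
theorem shk_sq_eq_log_norm_sq
    {n : ℕ} (hn : 1 ≤ n) (κ : ℝ) (hκ : 0 < κ)
    (μ0 μ1 : Measure (Eucl n)) [IsProbabilityMeasure μ0] [IsProbabilityMeasure μ1]
    (hμ0K : ∃ K : Set (Eucl n), IsCompact K ∧ μ0 Kᶜ = 0)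
    (hμ1K : ∃ K : Set (Eucl n), IsCompact K ∧ μ1 Kᶜ = 0)
    (hμ0ac : μ0 ≪ (volume : Measure (Eucl n)))
    (hHKpos : 0 < HK2 κ μ0 μ1)
    -- `π = (id,T)_# π0` is the unique minimizer of `E_κ(·|μ0,μ1)`
    (π : Measure (Eucl n × Eucl n)) [IsFiniteMeasure π]
    (hπopt : HKfun κ π μ0 μ1 = HK2 κ μ0 μ1)
    (hπuniq : ∀ π' : Measure (Eucl n × Eucl n), IsFiniteMeasure π' →
      HKfun κ π' μ0 μ1 = HK2 κ μ0 μ1 → π' = π)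
    (T : Eucl n → Eucl n) (hT : Measurable T)
    (hπT : π = (π.map Prod.fst).map (fun x => (x, T x)))
    -- the components `(v0, α0, μ1^⊥)` of the HK logarithmic map
    (v0 : Eucl n → Eucl n) (α0 : Eucl n → ℝ)
    (hv0 : ∀ᵐ x ∂(π.map Prod.fst), v0 x =
      (κ * ((π.map Prod.fst).rnDeriv μ0 x).toReal * Real.tan (‖T x - x‖ / κ) / ‖T x - x‖) •
        (T x - x))
    (hv0perp : ∀ᵐ x ∂(μ0.singularPart (π.map Prod.fst)), v0 x = 0)
    (hα0 : ∀ᵐ x ∂(π.map Prod.fst),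
      α0 x = 2 * (((π.map Prod.fst).rnDeriv μ0 x).toReal - 1))
    (hα0perp : ∀ᵐ x ∂(μ0.singularPart (π.map Prod.fst)), α0 x = -2)
    -- the rescaling factor `s'(0)` and the SHK logarithmic components
    (s'0 : ℝ) (hs'0 : s'0 = (SHK κ μ0 μ1 / κ) / Real.sin (SHK κ μ0 μ1 / κ))
    (v0S : Eucl n → Eucl n) (hv0S : v0S = fun x => s'0 • v0 x)
    (α0S : Eucl n → ℝ)
    (hα0S : α0S = fun x => s'0 * (α0 x + (HK2 κ μ0 μ1).toReal / κ ^ 2))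
    (μ1Sperp : Measure (Eucl n))
    (hμ1Sperp : μ1Sperp = ENNReal.ofReal (s'0 ^ 2) • μ1.singularPart (π.map Prod.snd)) :
    ENNReal.ofReal (SHK κ μ0 μ1 ^ 2)
      = ∫⁻ x, ENNReal.ofReal (‖v0S x‖ ^ 2) ∂μ0
        + ENNReal.ofReal (κ ^ 2 / 4) * ∫⁻ x, ENNReal.ofReal (α0S x ^ 2) ∂μ0
        + ENNReal.ofReal (κ ^ 2) * μ1Sperp Set.univ := by
  have hHKle := HK2_le_two_mul_sq κ μ0 μ1
  have hHKfin : HK2 κ μ0 μ1 ≠ ⊤ := (hHKle.trans_lt ofReal_lt_top).ne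
  have hfin : HKfun κ π μ0 μ1 ≠ ⊤ := hπopt ▸ hHKfin
  have hfoc := HKfun_first_order_condition hκ π μ0 μ1 hfin
    fun π' hπ' => hπopt.le.trans (iInf₂_le π' hπ')
  have hmass := toReal_HKfun_of_first_order hκ π μ0 μ1 hfin hfoc
  rw [hπopt] at hmass
  obtain ⟨-, k0, k1⟩ := (HKfun_ne_top_iff hκ π μ0 μ1).1 hfin
  have a0 := (InformationTheory.klDiv_ne_top_iff.1 k0).1
  have a1 := (InformationTheory.klDiv_ne_top_iff.1 k1).1
  have hHpos : 0 < (HK2 κ μ0 μ1).toReal := ENNReal.toReal_pos hHKpos.ne' hHKfin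
  set m : ℝ := π.real Set.univ with hm
  have hm0 : 0 ≤ m := measureReal_nonneg
  have hm1 : m < 1 := by
    rw [hmass] at hHpos
    have := pos_of_mul_pos_right hHpos (by positivity)
    linarith
  have hθ : SHK κ μ0 μ1 = κ * Real.arccos m := by
    rw [SHK, hmass]
    congr 2
    field_simp
    ring
  have hsin : Real.sin (Real.arccos m) ^ 2 = 1 - m ^ 2 := by
    rw [Real.sin_sq, Real.cos_arccos (by linarith) hm1.le]
  have hs : s'0 ^ 2 * (1 - m ^ 2) = Real.arccos m ^ 2 := by
    have hne : Real.sin (Real.arccos m) ^ 2 ≠ 0 := by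
      rw [hsin]; nlinarith
    rw [hs'0, hθ, mul_div_cancel_left₀ _ hκ.ne', div_pow, ← hsin, div_mul_cancel₀ _ hne]
  set u : Eucl n → ℝ := fun x => ((π.map Prod.fst).rnDeriv μ0 x).toReal with hu
  set G : Eucl n → ℝ := fun x => u x * (((π.map Prod.snd).rnDeriv μ1 (T x)).toReal)⁻¹ with hG
  have hv0' : ∀ᵐ x ∂μ0, v0 x =
      (κ * u x * Real.tan (‖T x - x‖ / κ) / ‖T x - x‖) • (T x - x) := by
    refine ae_of_ae_of_ae_singularPart hv0 ?_
    filter_upwards [hv0perp, ae_singularPart_rnDeriv_eq_zero μ0 (π.map Prod.fst)] with x hx hx'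
    simp [hx, hu, hx']
  have hα0' : ∀ᵐ x ∂μ0, α0 x = 2 * (u x - 1) := by
    refine ae_of_ae_of_ae_singularPart hα0 ?_
    filter_upwards [hα0perp, ae_singularPart_rnDeriv_eq_zero μ0 (π.map Prod.fst)] with x hx hx'
    simp [hx, hu, hx']
  have hkey : ∀ᵐ x ∂μ0, u x ^ 2 * (1 + Real.tan (‖T x - x‖ / κ) ^ 2) = G x :=
    ae_sq_mul_one_add_tan_sq_eq hκ π μ0 μ1 hfin hfoc T hT hπT
  obtain ⟨iG, hGval⟩ : Integrable G μ0 ∧ ∫ x, G x ∂μ0 = _ :=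
    integral_rnDeriv_mul_inv_comp π μ0 μ1 a0 a1 T hT hπT
  have iu : Integrable u μ0 := Measure.integrable_toReal_rnDeriv
  have huval : ∫ x, u x ∂μ0 = m := by
    rw [hu, Measure.integral_toReal_rnDeriv a0,
      map_measureReal_apply measurable_fst MeasurableSet.univ, Set.preimage_univ]
  have iu2 : Integrable (fun x => u x ^ 2) μ0 := by
    refine iG.mono' (iu.1.pow 2) ?_
    filter_upwards [hkey] with x hx
    rw [Real.norm_of_nonneg (sq_nonneg _), ← hx]
    nlinarith [mul_nonneg (sq_nonneg (u x)) (sq_nonneg (Real.tan (‖T x - x‖ / κ)))]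
  have hvS : ∫⁻ x, ENNReal.ofReal (‖v0S x‖ ^ 2) ∂μ0
      = ENNReal.ofReal (s'0 ^ 2 * κ ^ 2 * (∫ x, G x ∂μ0 - ∫ x, u x ^ 2 ∂μ0)) := by
    have hae : ∀ᵐ x ∂μ0, ‖v0S x‖ ^ 2 = s'0 ^ 2 * κ ^ 2 * (G x - u x ^ 2) := by
      filter_upwards [hv0', hkey] with x hx hx'
      have hnorm : ‖v0 x‖ ^ 2 = κ ^ 2 * (u x ^ 2 * Real.tan (‖T x - x‖ / κ) ^ 2) := by
        rw [hx, norm_smul, mul_pow, Real.norm_eq_abs, sq_abs]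
        rcases eq_or_ne ‖T x - x‖ 0 with h | h
        · simp [h]
        · field_simp
      rw [hv0S, norm_smul, mul_pow, Real.norm_eq_abs, sq_abs, hnorm, ← hx']
      ring
    rw [← integral_sub iG iu2]
    exact lintegral_ofReal_eq_ofReal_const_mul_integral (iG.sub iu2) (fun x => sq_nonneg _) hae
  have i1 : Integrable (fun x => u x ^ 2 - 2 * m * u x) μ0 := iu2.sub (iu.const_mul _)
  have hval : ∫ x, (u x ^ 2 - 2 * m * u x + m ^ 2) ∂μ0 = ∫ x, u x ^ 2 ∂μ0 - m ^ 2 := by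
    rw [integral_add i1 (integrable_const _), integral_sub iu2 (iu.const_mul _),
      integral_const_mul, huval, integral_const, probReal_univ]
    simp only [smul_eq_mul]
    ring
  have hαS : ∫⁻ x, ENNReal.ofReal (α0S x ^ 2) ∂μ0
      = ENNReal.ofReal (4 * s'0 ^ 2 * (∫ x, u x ^ 2 ∂μ0 - m ^ 2)) := by
    have hae : ∀ᵐ x ∂μ0, α0S x ^ 2 = 4 * s'0 ^ 2 * (u x ^ 2 - 2 * m * u x + m ^ 2) := by
      filter_upwards [hα0'] with x hx
      simp only [hα0S]
      rw [hx, hmass]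
      field_simp
      ring
    rw [← hval]
    exact lintegral_ofReal_eq_ofReal_const_mul_integral (i1.add (integrable_const _))
      (fun x => sq_nonneg _) hae
  have hperp : μ1.singularPart (π.map Prod.snd) Set.univ
      = ENNReal.ofReal (1 - ∫ x, G x ∂μ0) := by
    have hms : MeasurableSet {y | (π.map Prod.snd).rnDeriv μ1 y ≠ 0} :=
      (Measure.measurable_rnDeriv _ _ (measurableSet_singleton 0)).compl
    rw [singularPart_univ_eq a1, hGval, ← probReal_compl_eq_one_sub hms, ofReal_measureReal]
    congr 1
    ext y
    simp
  have hnG : 0 ≤ ∫ x, G x ∂μ0 - ∫ x, u x ^ 2 ∂μ0 := by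
    rw [← integral_sub iG iu2]
    refine integral_nonneg_of_ae (hkey.mono fun x hx => ?_)
    simp only [Pi.zero_apply]
    rw [← hx]
    nlinarith [mul_nonneg (sq_nonneg (u x)) (sq_nonneg (Real.tan (‖T x - x‖ / κ)))]
  have hnU : 0 ≤ ∫ x, u x ^ 2 ∂μ0 - m ^ 2 := by
    rw [← hval]
    refine integral_nonneg fun x => ?_
    simp only [Pi.zero_apply]
    nlinarith [sq_nonneg (u x - m)]
  have hnP : 0 ≤ 1 - ∫ x, G x ∂μ0 := by
    rw [hGval]
    linarith [measureReal_le_one (μ := μ1) (s := {y | (π.map Prod.snd).rnDeriv μ1 y ≠ 0})]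
  rw [hvS, hαS, hμ1Sperp, Measure.smul_apply, smul_eq_mul, hperp,
    ← ENNReal.ofReal_mul (by positivity), ← ENNReal.ofReal_mul (by positivity),
    ← ENNReal.ofReal_mul (by positivity), ← ENNReal.ofReal_add (by positivity) (by positivity),
    ← ENNReal.ofReal_add (by positivity) (by positivity), hθ, mul_pow, ← hs]
  congr 1
  ring
end

section
/- Let n ≥ 1, let K ⊂ ℝ^n be compact, let μ0, μ1 be Borel probability measures supported in K, and let (κ_m) be a sequence of positive reals with κ_m → ∞. For each m let π_m be a minimizer of E_{κ_m}(·|μ0,μ1). Then: (i) HK_{κ_m}²(μ0,μ1) → W2²(μ0,μ1) as m → ∞; (ii) the sequence (π_m) has a narrowly convergent subsequence, and every narrow limit of a subsequence of (π_m) is a coupling of (μ0,μ1) that is optimal for W2²(μ0,μ1). -/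
open MeasureTheory ENNReal Filter Topology RealInnerProductSpace
open scoped Classical

theorem Real.sq_div_two_le_neg_log_cos {t : ℝ} (h0 : 0 ≤ t) (h1 : t < Real.pi / 2) :
    t ^ 2 / 2 ≤ -Real.log (Real.cos t) := by
  have hcos : ∀ s ∈ Set.Ico (0 : ℝ) (Real.pi / 2), 0 < Real.cos s := fun s hs =>
    Real.cos_pos_of_mem_Ioo ⟨by linarith [hs.1, Real.pi_pos], hs.2⟩
  have hderiv : ∀ s ∈ Set.Ico (0 : ℝ) (Real.pi / 2),
      HasDerivAt (fun s => -Real.log (Real.cos s) - s ^ 2 / 2) (Real.tan s - s) s := by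
    intro s hs
    refine ((((Real.hasDerivAt_cos s).log (hcos s hs).ne').neg).sub
      ((hasDerivAt_pow 2 s).div_const 2)).congr_deriv ?_
    rw [Real.tan_eq_sin_div_cos]
    push_cast
    ring
  have hmono : MonotoneOn (fun s => -Real.log (Real.cos s) - s ^ 2 / 2)
      (Set.Ico 0 (Real.pi / 2)) := by
    refine monotoneOn_of_deriv_nonneg (convex_Ico _ _)
      (fun s hs => (hderiv s hs).continuousAt.continuousWithinAt) ?_ ?_
    · intro s hs
      exact (hderiv s (interior_subset hs)).differentiableAt.differentiableWithinAt
    · intro s hs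
      have hs' := interior_subset hs
      rw [(hderiv s hs').deriv]
      linarith [Real.le_tan hs'.1 hs'.2]
  have h := hmono ⟨le_rfl, by positivity⟩ ⟨h0, h1⟩ h0
  simp at h
  linarith

theorem Real.neg_log_cos_le {t : ℝ} (h : t ^ 2 ≤ 1) :
    -Real.log (Real.cos t) ≤ t ^ 2 / 2 + t ^ 4 / 2 := by
  have hc : 1 - t ^ 2 / 2 ≤ Real.cos t := Real.one_sub_sq_div_two_le_cos
  have hpos : 0 < 1 - t ^ 2 / 2 := by linarith
  have hlog := Real.one_sub_inv_le_log_of_pos (hpos.trans_le hc)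
  have hinv : (Real.cos t)⁻¹ ≤ (1 - t ^ 2 / 2)⁻¹ := inv_anti₀ hpos hc
  have hbd : (1 - t ^ 2 / 2)⁻¹ ≤ 1 + t ^ 2 / 2 + t ^ 4 / 2 := by
    rw [inv_le_iff_one_le_mul₀ hpos]
    nlinarith [mul_nonneg (sq_nonneg (t ^ 2)) (sub_nonneg.2 h)]
  linarith

theorem ofReal_dist_sq_le_cHK {n : ℕ} {κ : ℝ} (hκ : 0 < κ) (x y : Eucl n) :
    ENNReal.ofReal (dist x y ^ 2) ≤ cHK κ x y := by
  unfold cHK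
  split_ifs with h
  · apply ENNReal.ofReal_le_ofReal
    have := Real.sq_div_two_le_neg_log_cos (t := dist x y / κ) (by positivity)
      (by rw [div_lt_iff₀ hκ]; linarith)
    calc dist x y ^ 2 = 2 * κ ^ 2 * ((dist x y / κ) ^ 2 / 2) := by field_simp
      _ ≤ 2 * κ ^ 2 * -Real.log (Real.cos (dist x y / κ)) := by gcongr
      _ = _ := by ring
  · exact le_top

theorem cHK_le_of_dist_le {n : ℕ} {κ D : ℝ} (hκ : 0 < κ) (hD : D ≤ κ) {x y : Eucl n}
    (h : dist x y ≤ D) :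
    cHK κ x y ≤ ENNReal.ofReal (dist x y ^ 2) + ENNReal.ofReal (D ^ 4 / κ ^ 2) := by
  have hd : dist x y < κ * Real.pi / 2 := by nlinarith [Real.pi_gt_three]
  rw [cHK, if_pos hd, ← ENNReal.ofReal_add (by positivity) (by positivity)]
  apply ENNReal.ofReal_le_ofReal
  have h1 : (dist x y / κ) ^ 2 ≤ 1 :=
    pow_le_one₀ (by positivity) ((div_le_one hκ).2 (h.trans hD))
  calc -2 * κ ^ 2 * Real.log (Real.cos (dist x y / κ))
      = 2 * κ ^ 2 * -Real.log (Real.cos (dist x y / κ)) := by ring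
    _ ≤ 2 * κ ^ 2 * ((dist x y / κ) ^ 2 / 2 + (dist x y / κ) ^ 4 / 2) := by
        gcongr; exact Real.neg_log_cos_le h1
    _ = dist x y ^ 2 + dist x y ^ 4 / κ ^ 2 := by field_simp
    _ ≤ _ := by gcongr

theorem KLdiv_self {α : Type*} [MeasurableSpace α] (μ : Measure α) [SigmaFinite μ] :
    KLdiv μ μ = 0 := by
  rw [KLdiv, if_pos Measure.AbsolutelyContinuous.rfl]
  rw [lintegral_eq_zero_iff' (by fun_prop)]
  filter_upwards [μ.rnDeriv_self] with x hx
  simp [hx]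

theorem absolutelyContinuous_of_KLdiv_ne_top {α : Type*} [MeasurableSpace α] {ρ μ : Measure α}
    (h : KLdiv ρ μ ≠ ⊤) : ρ ≪ μ := by
  by_contra hc
  exact h (if_neg hc)

/-- Fenchel–Young inequality for the entropy density `s log s - s + 1`. -/
theorem Real.mul_sub_one_le_entropy (a : ℝ) {s : ℝ} (hs : 0 ≤ s) :
    a * (s - 1) ≤ (s * Real.log s - s + 1) + (Real.exp a - 1 - a) := by
  rcases hs.eq_or_lt with rfl | hs
  · simp
    linarith [Real.exp_pos a]
  · have h := mul_le_mul_of_nonneg_left (Real.add_one_le_exp (a - Real.log s)) hs.le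
    rw [Real.exp_sub, Real.exp_log hs, mul_div_cancel₀ _ hs.ne'] at h
    linarith

theorem Real.entropy_nonneg {s : ℝ} (hs : 0 ≤ s) : 0 ≤ s * Real.log s - s + 1 := by
  simpa using Real.mul_sub_one_le_entropy 0 hs

theorem Real.abs_sub_one_le_entropy {ε s : ℝ} (hε : 0 < ε) (hε1 : ε ≤ 1) (hs : 0 ≤ s) :
    |s - 1| ≤ (s * Real.log s - s + 1) / ε + ε := by
  have hexp : ∀ a : ℝ, |a| ≤ 1 → Real.exp a - 1 - a ≤ a ^ 2 := fun a ha =>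
    (le_abs_self _).trans (Real.abs_exp_sub_one_sub_id_le ha)
  have h1 := Real.mul_sub_one_le_entropy ε hs
  have h2 := Real.mul_sub_one_le_entropy (-ε) hs
  have h3 := hexp ε (by rwa [abs_of_pos hε])
  have h4 := hexp (-ε) (by rwa [abs_neg, abs_of_pos hε])
  have key : ε * |s - 1| ≤ (s * Real.log s - s + 1) + ε ^ 2 := by
    rcases abs_cases (s - 1) with ⟨h, -⟩ | ⟨h, -⟩ <;> rw [h] <;> nlinarith
  calc |s - 1| = ε * |s - 1| / ε := by field_simp
    _ ≤ ((s * Real.log s - s + 1) + ε ^ 2) / ε := by gcongr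
    _ = _ := by field_simp

theorem integrable_entropy_of_KLdiv_ne_top {α : Type*} [MeasurableSpace α] {ρ μ : Measure α}
    (h : KLdiv ρ μ ≠ ⊤) :
    Integrable (fun x => (ρ.rnDeriv μ x).toReal * Real.log (ρ.rnDeriv μ x).toReal
      - (ρ.rnDeriv μ x).toReal + 1) μ := by
  refine ⟨by fun_prop, ?_⟩
  rw [hasFiniteIntegral_iff_ofReal (ae_of_all _ fun x => Real.entropy_nonneg toReal_nonneg)]
  rw [KLdiv, if_pos (absolutelyContinuous_of_KLdiv_ne_top h)] at h
  exact h.lt_top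

theorem integral_entropy_eq_toReal_KLdiv {α : Type*} [MeasurableSpace α] {ρ μ : Measure α}
    (h : ρ ≪ μ) :
    ∫ x, ((ρ.rnDeriv μ x).toReal * Real.log (ρ.rnDeriv μ x).toReal
      - (ρ.rnDeriv μ x).toReal + 1) ∂μ = (KLdiv ρ μ).toReal := by
  rw [KLdiv, if_pos h, integral_eq_lintegral_of_nonneg_ae
    (ae_of_all _ fun x => Real.entropy_nonneg toReal_nonneg) (by fun_prop)]

section Narrow

variable {α : Type*} [MeasurableSpace α] [TopologicalSpace α]

theorem abs_integral_sub_integral_le_KLdiv [OpensMeasurableSpace α] {ρ μ : Measure α}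
    [IsFiniteMeasure ρ] [IsProbabilityMeasure μ] (h : KLdiv ρ μ ≠ ⊤) {ε : ℝ} (hε : 0 < ε)
    (hε1 : ε ≤ 1) (φ : BoundedContinuousFunction α ℝ) :
    |∫ x, φ x ∂ρ - ∫ x, φ x ∂μ| ≤ ‖φ‖ * ((KLdiv ρ μ).toReal / ε + ε) := by
  have hac := absolutelyContinuous_of_KLdiv_ne_top h
  have hφρ : Integrable (fun x => (ρ.rnDeriv μ x).toReal • φ x) μ :=
    (integrable_rnDeriv_smul_iff hac).2 (φ.integrable ρ)
  have hent := integrable_entropy_of_KLdiv_ne_top h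
  rw [← integral_rnDeriv_smul hac, ← integral_sub hφρ (φ.integrable μ)]
  have hb : Integrable (fun x => ‖φ‖ * (((ρ.rnDeriv μ x).toReal *
      Real.log (ρ.rnDeriv μ x).toReal - (ρ.rnDeriv μ x).toReal + 1) / ε + ε)) μ :=
    ((hent.div_const ε).add (integrable_const ε)).const_mul _
  calc _ ≤ ∫ x, ‖φ‖ * (((ρ.rnDeriv μ x).toReal * Real.log (ρ.rnDeriv μ x).toReal
          - (ρ.rnDeriv μ x).toReal + 1) / ε + ε) ∂μ := by
        rw [← Real.norm_eq_abs]
        refine norm_integral_le_of_norm_le hb (ae_of_all _ fun x => ?_)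
        have : (ρ.rnDeriv μ x).toReal • φ x - φ x = φ x * ((ρ.rnDeriv μ x).toReal - 1) := by
          simp; ring
        rw [this, norm_mul]
        exact mul_le_mul (φ.norm_coe_le_norm x)
          (Real.abs_sub_one_le_entropy hε hε1 toReal_nonneg) (by positivity) (by positivity)
    _ = _ := by
        rw [integral_const_mul, integral_add (hent.div_const ε) (integrable_const ε),
          integral_div, integral_entropy_eq_toReal_KLdiv hac]
        simp

theorem narrowTendsto_of_tendsto_KLdiv [OpensMeasurableSpace α] {ρ : ℕ → Measure α}
    {μ : Measure α} [∀ m, IsFiniteMeasure (ρ m)] [IsProbabilityMeasure μ]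
    (h : Tendsto (fun m => KLdiv (ρ m) μ) atTop (𝓝 0)) : NarrowTendsto ρ μ := by
  intro φ
  rw [Metric.tendsto_atTop']
  intro δ hδ
  obtain ⟨ε, hε, hε1, hεδ⟩ : ∃ ε : ℝ, 0 < ε ∧ ε ≤ 1 ∧ ‖φ‖ * (2 * ε) < δ := by
    refine ⟨min 1 (δ / (2 * ‖φ‖ + 1) / 2), by positivity, min_le_left _ _, ?_⟩
    calc ‖φ‖ * (2 * min 1 (δ / (2 * ‖φ‖ + 1) / 2))
        ≤ ‖φ‖ * (2 * (δ / (2 * ‖φ‖ + 1) / 2)) := by gcongr; exact min_le_right _ _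
      _ = δ * (‖φ‖ / (2 * ‖φ‖ + 1)) := by ring
      _ < δ * 1 := by
        gcongr
        rw [div_lt_one (by positivity)]
        linarith [norm_nonneg φ]
      _ = δ := mul_one _
  have hev : ∀ᶠ m in atTop, KLdiv (ρ m) μ < ENNReal.ofReal (ε ^ 2) :=
    h.eventually_lt_const (by positivity)
  obtain ⟨N, hN⟩ := eventually_atTop.1 hev
  refine ⟨N, fun m hm => ?_⟩
  have hm' := hN m hm.le
  have hle : (KLdiv (ρ m) μ).toReal ≤ ε ^ 2 :=
    ENNReal.toReal_le_of_le_ofReal (by positivity) hm'.le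
  rw [Real.dist_eq]
  calc _ ≤ ‖φ‖ * ((KLdiv (ρ m) μ).toReal / ε + ε) :=
        abs_integral_sub_integral_le_KLdiv hm'.ne_top hε hε1 φ
    _ ≤ ‖φ‖ * (ε ^ 2 / ε + ε) := by gcongr
    _ = ‖φ‖ * (2 * ε) := by field_simp; ring
    _ < δ := hεδ

theorem NarrowTendsto.tendsto_real_univ {ρ : ℕ → Measure α} {ρlim : Measure α}
    (h : NarrowTendsto ρ ρlim) :
    Tendsto (fun m => (ρ m).real Set.univ) atTop (𝓝 (ρlim.real Set.univ)) := by
  simpa using h 1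

theorem NarrowTendsto.map {β : Type*} [MeasurableSpace β] [TopologicalSpace β]
    [OpensMeasurableSpace α] [BorelSpace β]
    {ρ : ℕ → Measure α} {ρlim : Measure α} (h : NarrowTendsto ρ ρlim) {f : α → β}
    (hf : Continuous f) :
    NarrowTendsto (fun m => (ρ m).map f) (ρlim.map f) := by
  intro φ
  simpa [integral_map hf.aemeasurable φ.continuous.aestronglyMeasurable] using
    h (φ.compContinuous ⟨f, hf⟩)

theorem NarrowTendsto.unique [HasOuterApproxClosed α] [BorelSpace α] {ρ : ℕ → Measure α}
    {ρ₁ ρ₂ : Measure α} [IsFiniteMeasure ρ₁] [IsFiniteMeasure ρ₂]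
    (h₁ : NarrowTendsto ρ ρ₁) (h₂ : NarrowTendsto ρ ρ₂) : ρ₁ = ρ₂ :=
  ext_of_forall_integral_eq_of_IsFiniteMeasure fun φ => tendsto_nhds_unique (h₁ φ) (h₂ φ)

end Narrow

theorem exists_narrowTendsto_subseq {α : Type*} [MeasurableSpace α] [MetricSpace α]
    [SecondCountableTopology α] [BorelSpace α] {C : Set α} (hC : IsCompact C)
    (ρ : ℕ → Measure α) [∀ m, IsFiniteMeasure (ρ m)]
    (hmass : Tendsto (fun m => (ρ m).real Set.univ) atTop (𝓝 1))
    (hsupp : ∀ᶠ m in atTop, ρ m Cᶜ = 0) :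
    ∃ (ψ : ℕ → ℕ) (ρlim : Measure α), StrictMono ψ ∧ NarrowTendsto (fun k => ρ (ψ k)) ρlim := by
  obtain ⟨N, hN⟩ := eventually_atTop.1
    (hsupp.and (hmass.eventually_ne one_ne_zero))
  have hne : ∀ k, ρ (k + N) ≠ 0 := fun k h0 => (hN (k + N) (by omega)).2 (by simp [h0])
  let ν : ℕ → ProbabilityMeasure α := fun k =>
    ⟨(ρ (k + N) Set.univ)⁻¹ • ρ (k + N),
      haveI : NeZero (ρ (k + N)) := ⟨hne k⟩
      isProbabilityMeasureSMul⟩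
  let S : Set (ProbabilityMeasure α) := {ν | (ν : Measure α) Cᶜ = 0}
  have hS : IsTightMeasureSet {((μ : ProbabilityMeasure α) : Measure α) | μ ∈ S} := by
    rw [isTightMeasureSet_iff_exists_isCompact_measure_compl_le]
    refine fun ε _ => ⟨C, hC, ?_⟩
    rintro _ ⟨μ, hμ, rfl⟩
    have : (μ : Measure α) Cᶜ = 0 := hμ
    simp [this]
  have hνS : ∀ k, ν k ∈ closure S := fun k => subset_closure (by
    change ((ρ (k + N) Set.univ)⁻¹ • ρ (k + N)) Cᶜ = 0
    simp [(hN (k + N) (by omega)).1])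
  obtain ⟨νlim, -, ψ, hψ, hlim⟩ :=
    (isCompact_closure_of_isTightMeasureSet hS).isSeqCompact hνS
  refine ⟨fun k => ψ k + N, νlim, fun a b hab => Nat.add_lt_add_right (hψ hab) N, fun φ => ?_⟩
  have h1 := ProbabilityMeasure.tendsto_iff_forall_integral_tendsto.1 hlim φ
  have h2 : Tendsto (fun k => (ρ (ψ k + N)).real Set.univ) atTop (𝓝 1) :=
    hmass.comp ((tendsto_add_atTop_nat N).comp hψ.tendsto_atTop)
  have h3 := h2.mul h1
  rw [one_mul] at h3
  refine h3.congr fun k => ?_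
  have hk : (ρ (ψ k + N)).real Set.univ ≠ 0 := (hN (ψ k + N) (by omega)).2
  simp only [Function.comp, ν, ProbabilityMeasure.coe_mk, integral_smul_measure, smul_eq_mul,
    ENNReal.toReal_inv]
  rw [← Measure.real, mul_inv_cancel_left₀ hk]

theorem measure_prod_compl_eq_zero {α β : Type*} [MeasurableSpace α] [MeasurableSpace β]
    {ρ : Measure (α × β)} {A : Set α} {B : Set β} (hA : MeasurableSet A) (hB : MeasurableSet B)
    (h0 : ρ.map Prod.fst Aᶜ = 0) (h1 : ρ.map Prod.snd Bᶜ = 0) : ρ (A ×ˢ B)ᶜ = 0 := by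
  rw [Measure.map_apply measurable_fst hA.compl] at h0
  rw [Measure.map_apply measurable_snd hB.compl] at h1
  rw [Set.compl_prod_eq_union]
  refine measure_mono_null ?_ (measure_union_null h0 h1)
  rintro ⟨a, b⟩ hab
  simpa using hab

theorem lintegral_dist_sq_le_HKfun {n : ℕ} {κ : ℝ} (hκ : 0 < κ)
    (π : Measure (Eucl n × Eucl n)) (μ0 μ1 : Measure (Eucl n)) :
    ∫⁻ p, ENNReal.ofReal (dist p.1 p.2 ^ 2) ∂π ≤ HKfun κ π μ0 μ1 :=
  calc ∫⁻ p, ENNReal.ofReal (dist p.1 p.2 ^ 2) ∂π ≤ ∫⁻ p, cHK κ p.1 p.2 ∂π := by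
        apply lintegral_mono
        intro p
        exact ofReal_dist_sq_le_cHK hκ p.1 p.2
    _ ≤ HKfun κ π μ0 μ1 := le_self_add.trans le_self_add

theorem KLdiv_map_fst_le_HKfun {n : ℕ} (κ : ℝ) (π : Measure (Eucl n × Eucl n))
    (μ0 μ1 : Measure (Eucl n)) :
    ENNReal.ofReal (κ ^ 2) * KLdiv (π.map Prod.fst) μ0 ≤ HKfun κ π μ0 μ1 :=
  le_add_self.trans le_self_add

theorem KLdiv_map_snd_le_HKfun {n : ℕ} (κ : ℝ) (π : Measure (Eucl n × Eucl n))
    (μ0 μ1 : Measure (Eucl n)) :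
    ENNReal.ofReal (κ ^ 2) * KLdiv (π.map Prod.snd) μ1 ≤ HKfun κ π μ0 μ1 :=
  le_add_self

section Limit

variable {n : ℕ} {K : Set (Eucl n)} {μ0 μ1 : Measure (Eucl n)}

theorem ae_dist_le_diam (hK : IsCompact K) {ρ : Measure (Eucl n × Eucl n)}
    (h : ρ (K ×ˢ K)ᶜ = 0) : ∀ᵐ p ∂ρ, dist p.1 p.2 ≤ Metric.diam K := by
  have h' : ∀ᵐ p ∂ρ, p ∈ K ×ˢ K := h
  filter_upwards [h'] with p hp
  exact Metric.dist_le_diam_of_mem hK.isBounded hp.1 hp.2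

theorem W2sq_le_lintegral {γ : Measure (Eucl n × Eucl n)} (h0 : γ.map Prod.fst = μ0)
    (h1 : γ.map Prod.snd = μ1) :
    W2sq μ0 μ1 ≤ ∫⁻ p, ENNReal.ofReal (dist p.1 p.2 ^ 2) ∂γ :=
  iInf₂_le (f := fun (γ : Measure (Eucl n × Eucl n))
    (_ : γ.map Prod.fst = μ0 ∧ γ.map Prod.snd = μ1) =>
      ∫⁻ p, ENNReal.ofReal (dist p.1 p.2 ^ 2) ∂γ) γ ⟨h0, h1⟩

theorem HK2_le_HKfun {κ : ℝ} {γ : Measure (Eucl n × Eucl n)} [hγ : IsFiniteMeasure γ] :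
    HK2 κ μ0 μ1 ≤ HKfun κ γ μ0 μ1 :=
  iInf₂_le (f := fun (γ : Measure (Eucl n × Eucl n)) (_ : IsFiniteMeasure γ) =>
    HKfun κ γ μ0 μ1) γ hγ

theorem HK2_le_W2sq_add [IsProbabilityMeasure μ0] [IsProbabilityMeasure μ1] (hK : IsCompact K)
    (hμ0K : μ0 Kᶜ = 0) (hμ1K : μ1 Kᶜ = 0) {κ : ℝ} (hκ : 0 < κ) (hD : Metric.diam K ≤ κ) :
    HK2 κ μ0 μ1 ≤ W2sq μ0 μ1 + ENNReal.ofReal (Metric.diam K ^ 4 / κ ^ 2) := by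
  rw [W2sq, ENNReal.iInf_add]
  refine le_iInf fun γ => ?_
  rw [ENNReal.iInf_add]
  refine le_iInf fun hγ => ?_
  have hγp : IsProbabilityMeasure γ := by
    constructor
    have := congrArg (fun μ : Measure (Eucl n) => μ Set.univ) hγ.1
    simpa [Measure.map_apply measurable_fst MeasurableSet.univ] using this
  have hsupp : γ (K ×ˢ K)ᶜ = 0 :=
    measure_prod_compl_eq_zero hK.measurableSet hK.measurableSet (hγ.1 ▸ hμ0K) (hγ.2 ▸ hμ1K)
  calc HK2 κ μ0 μ1 ≤ HKfun κ γ μ0 μ1 := HK2_le_HKfun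
    _ = ∫⁻ p, cHK κ p.1 p.2 ∂γ := by simp [HKfun, hγ.1, hγ.2, KLdiv_self]
    _ ≤ ∫⁻ p, (ENNReal.ofReal (dist p.1 p.2 ^ 2)
          + ENNReal.ofReal (Metric.diam K ^ 4 / κ ^ 2)) ∂γ := by
        apply lintegral_mono_ae
        filter_upwards [ae_dist_le_diam hK hsupp] with p hp
        exact cHK_le_of_dist_le hκ hD hp
    _ = _ := by
        rw [lintegral_add_right _ measurable_const]
        simp

theorem W2sq_lt_top [IsProbabilityMeasure μ0] [IsProbabilityMeasure μ1] (hK : IsCompact K)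
    (hμ0K : μ0 Kᶜ = 0) (hμ1K : μ1 Kᶜ = 0) : W2sq μ0 μ1 < ⊤ := by
  have h0 : (μ0.prod μ1).map Prod.fst = μ0 := by simp [Measure.map_fst_prod]
  have h1 : (μ0.prod μ1).map Prod.snd = μ1 := by simp [Measure.map_snd_prod]
  have hsupp : (μ0.prod μ1) (K ×ˢ K)ᶜ = 0 :=
    measure_prod_compl_eq_zero hK.measurableSet hK.measurableSet (h0.symm ▸ hμ0K)
      (h1.symm ▸ hμ1K)
  calc W2sq μ0 μ1 ≤ ∫⁻ p, ENNReal.ofReal (dist p.1 p.2 ^ 2) ∂(μ0.prod μ1) :=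
        W2sq_le_lintegral h0 h1
    _ ≤ ∫⁻ _, ENNReal.ofReal (Metric.diam K ^ 2) ∂(μ0.prod μ1) := by
        apply lintegral_mono_ae
        filter_upwards [ae_dist_le_diam hK hsupp] with p hp
        gcongr
    _ < ⊤ := by simp

/-- The squared distance truncated at height `D ^ 2`, as a bounded continuous function. -/
noncomputable def truncDistSq (n : ℕ) (D : ℝ) :
    BoundedContinuousFunction (Eucl n × Eucl n) ℝ :=
  BoundedContinuousFunction.ofNormedAddCommGroup
    (fun p => min (dist p.1 p.2 ^ 2) (D ^ 2)) (by fun_prop) (D ^ 2) fun p => by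
      rw [Real.norm_of_nonneg (by positivity)]
      exact min_le_right _ _

theorem lintegral_dist_sq_eq_integral_truncDistSq (hK : IsCompact K)
    {ρ : Measure (Eucl n × Eucl n)} [IsFiniteMeasure ρ] (h : ρ (K ×ˢ K)ᶜ = 0) :
    ∫⁻ p, ENNReal.ofReal (dist p.1 p.2 ^ 2) ∂ρ
      = ENNReal.ofReal (∫ p, truncDistSq n (Metric.diam K) p ∂ρ) := by
  rw [ofReal_integral_eq_lintegral_ofReal (BoundedContinuousFunction.integrable ρ _)
    (ae_of_all _ fun p => le_min (by positivity) (by positivity))]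
  apply lintegral_congr_ae
  filter_upwards [ae_dist_le_diam hK h] with p hp
  change _ = ENNReal.ofReal (min _ _)
  rw [min_eq_left (by gcongr)]

theorem tendsto_W2sq_add_error {κ : ℕ → ℝ} (hκtop : Tendsto κ atTop atTop) :
    Tendsto (fun m => W2sq μ0 μ1 + ENNReal.ofReal (Metric.diam K ^ 4 / κ m ^ 2)) atTop
      (𝓝 (W2sq μ0 μ1)) := by
  have h : Tendsto (fun m => ENNReal.ofReal (Metric.diam K ^ 4 / κ m ^ 2)) atTop (𝓝 0) := by
    rw [← ENNReal.ofReal_zero]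
    exact ENNReal.tendsto_ofReal
      (tendsto_const_nhds.div_atTop ((tendsto_pow_atTop two_ne_zero).comp hκtop))
  simpa using tendsto_const_nhds.add h

variable [IsProbabilityMeasure μ0] [IsProbabilityMeasure μ1] {κ : ℕ → ℝ}
  {π : ℕ → Measure (Eucl n × Eucl n)}

theorem eventually_HK2_le (hK : IsCompact K) (hμ0K : μ0 Kᶜ = 0) (hμ1K : μ1 Kᶜ = 0)
    (hκtop : Tendsto κ atTop atTop) :
    ∀ᶠ m in atTop, HK2 (κ m) μ0 μ1
      ≤ W2sq μ0 μ1 + ENNReal.ofReal (Metric.diam K ^ 4 / κ m ^ 2) := by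
  filter_upwards [hκtop.eventually_gt_atTop 0, hκtop.eventually_ge_atTop (Metric.diam K)]
    with m h0 hD
  exact HK2_le_W2sq_add hK hμ0K hμ1K h0 hD

theorem tendsto_KLdiv_of_mul_le_HK2 (hK : IsCompact K) (hμ0K : μ0 Kᶜ = 0) (hμ1K : μ1 Kᶜ = 0)
    (hκtop : Tendsto κ atTop atTop) {d : ℕ → ℝ≥0∞}
    (hd : ∀ m, ENNReal.ofReal (κ m ^ 2) * d m ≤ HK2 (κ m) μ0 μ1) :
    Tendsto d atTop (𝓝 0) := by
  have hW := W2sq_lt_top hK hμ0K hμ1K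
  have hbound : ∀ᶠ m in atTop, HK2 (κ m) μ0 μ1 ≤ W2sq μ0 μ1 + 1 := by
    filter_upwards [eventually_HK2_le hK hμ0K hμ1K hκtop,
      (tendsto_W2sq_add_error (μ0 := μ0) (μ1 := μ1) (K := K) hκtop).eventually_lt_const
        (ENNReal.lt_add_right hW.ne one_ne_zero)] with m h1 h2
    exact h1.trans h2.le
  have hκ2 : Tendsto (fun m => ENNReal.ofReal (κ m ^ 2)) atTop (𝓝 ⊤) :=
    ENNReal.tendsto_ofReal_atTop.comp ((tendsto_pow_atTop two_ne_zero).comp hκtop)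
  have hlim : Tendsto (fun m => (W2sq μ0 μ1 + 1) / ENNReal.ofReal (κ m ^ 2)) atTop (𝓝 0) := by
    have := ENNReal.Tendsto.const_div (a := W2sq μ0 μ1 + 1) hκ2
      (Or.inr (ENNReal.add_ne_top.2 ⟨hW.ne, one_ne_top⟩))
    simpa using this
  refine tendsto_of_tendsto_of_tendsto_of_le_of_le' tendsto_const_nhds hlim
    (Eventually.of_forall fun _ => zero_le) ?_
  filter_upwards [hbound, hκtop.eventually_gt_atTop 0] with m hm h0
  rw [ENNReal.le_div_iff_mul_le (Or.inl (by positivity)) (Or.inl ofReal_ne_top), mul_comm]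
  exact (hd m).trans hm

theorem tendsto_KLdiv_marginals (hK : IsCompact K) (hμ0K : μ0 Kᶜ = 0) (hμ1K : μ1 Kᶜ = 0)
    (hκtop : Tendsto κ atTop atTop) (hπmin : ∀ m, HKfun (κ m) (π m) μ0 μ1 = HK2 (κ m) μ0 μ1) :
    Tendsto (fun m => KLdiv ((π m).map Prod.fst) μ0) atTop (𝓝 0) ∧
    Tendsto (fun m => KLdiv ((π m).map Prod.snd) μ1) atTop (𝓝 0) :=
  ⟨tendsto_KLdiv_of_mul_le_HK2 hK hμ0K hμ1K hκtop fun m =>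
      (KLdiv_map_fst_le_HKfun _ _ _ _).trans_eq (hπmin m),
    tendsto_KLdiv_of_mul_le_HK2 hK hμ0K hμ1K hκtop fun m =>
      (KLdiv_map_snd_le_HKfun _ _ _ _).trans_eq (hπmin m)⟩

theorem eventually_measure_compl_eq_zero (hK : IsCompact K) (hμ0K : μ0 Kᶜ = 0)
    (hμ1K : μ1 Kᶜ = 0) (hκtop : Tendsto κ atTop atTop)
    (hπmin : ∀ m, HKfun (κ m) (π m) μ0 μ1 = HK2 (κ m) μ0 μ1) :
    ∀ᶠ m in atTop, π m (K ×ˢ K)ᶜ = 0 := by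
  obtain ⟨h0, h1⟩ := tendsto_KLdiv_marginals hK hμ0K hμ1K hκtop hπmin
  filter_upwards [h0.eventually_lt_const zero_lt_one, h1.eventually_lt_const zero_lt_one]
    with m hm0 hm1
  exact measure_prod_compl_eq_zero hK.measurableSet hK.measurableSet
    (absolutelyContinuous_of_KLdiv_ne_top hm0.ne_top hμ0K)
    (absolutelyContinuous_of_KLdiv_ne_top hm1.ne_top hμ1K)

variable [∀ m, IsFiniteMeasure (π m)]

theorem tendsto_real_univ_of_minimizers (hK : IsCompact K) (hμ0K : μ0 Kᶜ = 0)
    (hμ1K : μ1 Kᶜ = 0) (hκtop : Tendsto κ atTop atTop)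
    (hπmin : ∀ m, HKfun (κ m) (π m) μ0 μ1 = HK2 (κ m) μ0 μ1) :
    Tendsto (fun m => (π m).real Set.univ) atTop (𝓝 1) := by
  have h := (narrowTendsto_of_tendsto_KLdiv
    (tendsto_KLdiv_marginals hK hμ0K hμ1K hκtop hπmin).1).tendsto_real_univ
  simpa [map_measureReal_apply measurable_fst MeasurableSet.univ] using h

theorem exists_narrowTendsto_subseq_of_minimizers (hK : IsCompact K) (hμ0K : μ0 Kᶜ = 0)
    (hμ1K : μ1 Kᶜ = 0) (hκtop : Tendsto κ atTop atTop)
    (hπmin : ∀ m, HKfun (κ m) (π m) μ0 μ1 = HK2 (κ m) μ0 μ1) :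
    ∃ (ψ : ℕ → ℕ) (πlim : Measure (Eucl n × Eucl n)), StrictMono ψ ∧
      NarrowTendsto (fun k => π (ψ k)) πlim :=
  exists_narrowTendsto_subseq (hK.prod hK) π
    (tendsto_real_univ_of_minimizers hK hμ0K hμ1K hκtop hπmin)
    (eventually_measure_compl_eq_zero hK hμ0K hμ1K hκtop hπmin)

theorem optimal_of_narrowTendsto (hK : IsCompact K) (hμ0K : μ0 Kᶜ = 0) (hμ1K : μ1 Kᶜ = 0)
    (hκtop : Tendsto κ atTop atTop)
    (hπmin : ∀ m, HKfun (κ m) (π m) μ0 μ1 = HK2 (κ m) μ0 μ1)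
    {πlim : Measure (Eucl n × Eucl n)} (hlim : NarrowTendsto π πlim) :
    (πlim.map Prod.fst = μ0 ∧ πlim.map Prod.snd = μ1 ∧
      ∫⁻ p, ENNReal.ofReal (dist p.1 p.2 ^ 2) ∂πlim = W2sq μ0 μ1) ∧
    Tendsto (fun m => HK2 (κ m) μ0 μ1) atTop (𝓝 (W2sq μ0 μ1)) := by
  have hfin : IsFiniteMeasure πlim := by
    have h1 : πlim.real Set.univ = 1 := tendsto_nhds_unique hlim.tendsto_real_univ
      (tendsto_real_univ_of_minimizers hK hμ0K hμ1K hκtop hπmin)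
    refine ⟨lt_top_iff_ne_top.2 fun htop => ?_⟩
    simp [Measure.real, htop] at h1
  obtain ⟨hKL0, hKL1⟩ := tendsto_KLdiv_marginals hK hμ0K hμ1K hκtop hπmin
  have hm0 : πlim.map Prod.fst = μ0 :=
    (hlim.map continuous_fst).unique (narrowTendsto_of_tendsto_KLdiv hKL0)
  have hm1 : πlim.map Prod.snd = μ1 :=
    (hlim.map continuous_snd).unique (narrowTendsto_of_tendsto_KLdiv hKL1)
  have hsupp : πlim (K ×ˢ K)ᶜ = 0 :=
    measure_prod_compl_eq_zero hK.measurableSet hK.measurableSet (hm0.symm ▸ hμ0K)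
      (hm1.symm ▸ hμ1K)
  have hcost : Tendsto (fun m => ∫⁻ p, ENNReal.ofReal (dist p.1 p.2 ^ 2) ∂(π m)) atTop
      (𝓝 (∫⁻ p, ENNReal.ofReal (dist p.1 p.2 ^ 2) ∂πlim)) := by
    rw [lintegral_dist_sq_eq_integral_truncDistSq hK hsupp]
    have h := ENNReal.tendsto_ofReal (hlim (truncDistSq n (Metric.diam K)))
    refine h.congr' ?_
    filter_upwards [eventually_measure_compl_eq_zero hK hμ0K hμ1K hκtop hπmin] with m hm
    exact (lintegral_dist_sq_eq_integral_truncDistSq hK hm).symm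
  have hlower : ∀ᶠ m in atTop,
      ∫⁻ p, ENNReal.ofReal (dist p.1 p.2 ^ 2) ∂(π m) ≤ HK2 (κ m) μ0 μ1 := by
    filter_upwards [hκtop.eventually_gt_atTop 0] with m hm
    exact (lintegral_dist_sq_le_HKfun hm _ _ _).trans_eq (hπmin m)
  have hupper := eventually_HK2_le hK hμ0K hμ1K hκtop
  have herr := tendsto_W2sq_add_error (μ0 := μ0) (μ1 := μ1) (K := K) hκtop
  have hopt : ∫⁻ p, ENNReal.ofReal (dist p.1 p.2 ^ 2) ∂πlim = W2sq μ0 μ1 := by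
    refine le_antisymm (le_of_tendsto_of_tendsto hcost herr ?_) (W2sq_le_lintegral hm0 hm1)
    filter_upwards [hlower, hupper] with m h1 h2
    exact h1.trans h2
  rw [hopt] at hcost
  exact ⟨⟨hm0, hm1, hopt⟩,
    tendsto_of_tendsto_of_tendsto_of_le_of_le' hcost herr hlower hupper⟩

end Limit

/-- convergence of `HK_κ²` and of optimal plans to `W2²` as `κ → ∞`. -/
theorem hk_to_w2_as_kappa_to_infty
    {n : ℕ} (hn : 1 ≤ n) (K : Set (Eucl n)) (hK : IsCompact K)
    (μ0 μ1 : Measure (Eucl n)) [IsProbabilityMeasure μ0] [IsProbabilityMeasure μ1]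
    (hμ0K : μ0 Kᶜ = 0) (hμ1K : μ1 Kᶜ = 0)
    (κ : ℕ → ℝ) (hκpos : ∀ m, 0 < κ m) (hκtop : Tendsto κ atTop atTop)
    (π : ℕ → Measure (Eucl n × Eucl n)) [∀ m, IsFiniteMeasure (π m)]
    (hπmin : ∀ m, HKfun (κ m) (π m) μ0 μ1 = HK2 (κ m) μ0 μ1) :
    Tendsto (fun m => HK2 (κ m) μ0 μ1) atTop (𝓝 (W2sq μ0 μ1)) ∧
    (∃ (ψ : ℕ → ℕ) (πlim : Measure (Eucl n × Eucl n)), StrictMono ψ ∧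
      NarrowTendsto (fun k => π (ψ k)) πlim) ∧
    (∀ (ψ : ℕ → ℕ), StrictMono ψ → ∀ πlim : Measure (Eucl n × Eucl n),
      NarrowTendsto (fun k => π (ψ k)) πlim →
        πlim.map Prod.fst = μ0 ∧ πlim.map Prod.snd = μ1 ∧
        ∫⁻ p, ENNReal.ofReal (dist p.1 p.2 ^ 2) ∂πlim = W2sq μ0 μ1) := by
  refine ⟨tendsto_of_subseq_tendsto fun ns hns => ?_, ?_, fun ψ hψ πlim hlim => ?_⟩
  · have hκns := hκtop.comp hns
    obtain ⟨ψ, πlim, hψ, hlim⟩ := exists_narrowTendsto_subseq_of_minimizers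
      (π := fun k => π (ns k)) hK hμ0K hμ1K hκns fun k => hπmin (ns k)
    exact ⟨ψ, (optimal_of_narrowTendsto (π := fun k => π (ns (ψ k))) hK hμ0K hμ1K
      (hκns.comp hψ.tendsto_atTop) (fun k => hπmin (ns (ψ k))) hlim).2⟩
  · exact exists_narrowTendsto_subseq_of_minimizers hK hμ0K hμ1K hκtop hπmin
  · exact (optimal_of_narrowTendsto (π := fun k => π (ψ k)) hK hμ0K hμ1K
      (hκtop.comp hψ.tendsto_atTop) (fun k => hπmin (ψ k)) hlim).1
end
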